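/- Let n ≥ 3 and 1 ≤ p ≤ n/(n−2). If u ∈ C^∞(ℝⁿ) is positive and satisfies the Matukuma equation −Δu(x) = u(x)^p/(1+|x|²) for all x ∈ ℝⁿ, then u is radially symmetric about the origin. -/

import Mathlib

open scoped BigOperators

/-- The Euclidean Laplacian of `u : ℝⁿ → ℝ` at `x`, as the sum of the pure second
derivatives in the standard coordinate directions. -/
noncomputable def eLaplacian {n : ℕ} (u : EuclideanSpace ℝ (Fin n) → ℝ)
    (x : EuclideanSpace ℝ (Fin n)) : ℝ :=
  ∑ i : Fin n, iteratedFDeriv ℝ 2 u x ![EuclideanSpace.single i 1, EuclideanSpace.single i 1]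

open Filter Topology InnerProductSpace EuclideanGeometry
open scoped Laplacian RealInnerProductSpace

section Calculus

variable {E : Type*} [NormedAddCommGroup E] [InnerProductSpace ℝ E]

theorem hasDerivAt_quadratic (q c t : ℝ) :
    HasDerivAt (fun t => q + 2 * t * c + t ^ 2) (2 * c + 2 * t) t := by
  have h := ((((hasDerivAt_id t).const_mul 2).mul_const c).const_add q).add (hasDerivAt_pow 2 t)
  exact h.congr_deriv (by simp)

theorem norm_add_smul_sq (z e : E) (he : ‖e‖ = 1) (t : ℝ) :
    ‖z + t • e‖ ^ 2 = ‖z‖ ^ 2 + 2 * t * ⟪z, e⟫ + t ^ 2 := by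
  rw [norm_add_sq_real, inner_smul_right, norm_smul, he]
  simp
  ring

theorem deriv_deriv_eq_of_eventually_hasDerivAt {g g' : ℝ → ℝ} {c t₀ : ℝ}
    (h : ∀ᶠ t in 𝓝 t₀, HasDerivAt g (g' t) t) (h' : HasDerivAt g' c t₀) :
    deriv (deriv g) t₀ = c := by
  have : deriv g =ᶠ[𝓝 t₀] g' := h.mono fun t ht => ht.deriv
  rw [this.deriv_eq, h'.deriv]

theorem eventually_hasDerivAt_comp_curve {f : E → ℝ} {γ γ' : ℝ → E} {t₀ : ℝ}
    (hf : ContDiffAt ℝ 2 f (γ t₀)) (hγ : ∀ᶠ t in 𝓝 t₀, HasDerivAt γ (γ' t) t) :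
    ∀ᶠ t in 𝓝 t₀, HasDerivAt (fun s => f (γ s)) (fderiv ℝ f (γ t) (γ' t)) t := by
  have hc : ContinuousAt γ t₀ := hγ.self_of_nhds.continuousAt
  have h1 : ∀ᶠ x in 𝓝 (γ t₀), ContDiffAt ℝ 2 f x := hf.eventually (by simp)
  filter_upwards [hc.eventually h1, hγ] with t ht ht'
  exact (ht.differentiableAt (by norm_num)).hasFDerivAt.comp_hasDerivAt t ht'

theorem hasDerivAt_fderiv_apply_curve {f : E → ℝ} {γ γ' : ℝ → E} {γ'' : E} {t₀ : ℝ}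
    (hf : ContDiffAt ℝ 2 f (γ t₀)) (hγ : HasDerivAt γ (γ' t₀) t₀)
    (hγ' : HasDerivAt γ' γ'' t₀) :
    HasDerivAt (fun t => fderiv ℝ f (γ t) (γ' t))
      (fderiv ℝ (fderiv ℝ f) (γ t₀) (γ' t₀) (γ' t₀) + fderiv ℝ f (γ t₀) γ'') t₀ := by
  have h1 : ContDiffAt ℝ 1 (fderiv ℝ f) (γ t₀) := hf.fderiv_right (by norm_num)
  have h2 := (h1.differentiableAt (by norm_num)).hasFDerivAt.comp_hasDerivAt t₀ hγ
  exact h2.clm_apply hγ'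

theorem deriv_deriv_line {f : E → ℝ} {x : E} (hf : ContDiffAt ℝ 2 f x) (e : E) :
    deriv (deriv fun t : ℝ => f (x + t • e)) 0 = fderiv ℝ (fderiv ℝ f) x e e := by
  have hγ : ∀ t : ℝ, HasDerivAt (fun t : ℝ => x + t • e) e t := fun t => by
    simpa using ((hasDerivAt_id t).smul_const e).const_add x
  have hx : x + (0 : ℝ) • e = x := by simp
  have h1 := eventually_hasDerivAt_comp_curve (f := f) (γ := fun t : ℝ => x + t • e)
    (γ' := fun _ => e) (t₀ := 0) (by simpa using hf) (Eventually.of_forall hγ)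
  have h2 := hasDerivAt_fderiv_apply_curve (f := f) (γ := fun t : ℝ => x + t • e)
    (γ' := fun _ => e) (γ'' := 0) (t₀ := 0) (by simpa using hf) (hγ 0) (hasDerivAt_const _ _)
  rw [deriv_deriv_eq_of_eventually_hasDerivAt h1 h2]
  simp

theorem deriv_deriv_nonneg_of_isLocalMin {g : ℝ → ℝ} {x : ℝ} (h : IsLocalMin g x)
    (hc : ContinuousAt g x) : 0 ≤ deriv (deriv g) x := by
  by_contra! hneg
  have hmax := isLocalMax_of_deriv_deriv_neg hneg h.deriv_eq_zero hc
  have hconst : g =ᶠ[𝓝 x] fun _ => g x := by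
    filter_upwards [h, hmax] with y h1 h2 using le_antisymm h2 h1
  have h1 : deriv g =ᶠ[𝓝 x] fun _ => 0 := by
    filter_upwards [hconst.eventually_nhds] with y hy
    rw [EventuallyEq.deriv_eq hy]
    simp
  rw [h1.deriv_eq] at hneg
  simp at hneg

variable [FiniteDimensional ℝ E]

theorem laplacian_eq_sum_fderiv {ι : Type*} [Fintype ι] (b : OrthonormalBasis ι ℝ E)
    (f : E → ℝ) (x : E) : Δ f x = ∑ i, fderiv ℝ (fderiv ℝ f) x (b i) (b i) := by
  rw [laplacian_eq_iteratedFDeriv_orthonormalBasis f b]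
  simp [iteratedFDeriv_two_apply]

theorem laplacian_eq_sum_deriv_deriv {ι : Type*} [Fintype ι] (b : OrthonormalBasis ι ℝ E)
    {f : E → ℝ} {x : E} (hf : ContDiffAt ℝ 2 f x) :
    Δ f x = ∑ i, deriv (deriv fun t : ℝ => f (x + t • b i)) 0 := by
  simp [laplacian_eq_sum_fderiv b, deriv_deriv_line hf]

theorem laplacian_nonneg_of_isLocalMin {f : E → ℝ} {x : E} (h : IsLocalMin f x)
    (hf : ContDiffAt ℝ 2 f x) : 0 ≤ Δ f x := by
  rw [laplacian_eq_sum_deriv_deriv (stdOrthonormalBasis ℝ E) hf]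
  refine Finset.sum_nonneg fun i _ => ?_
  set e := stdOrthonormalBasis ℝ E i
  have hc : ContinuousAt (fun t : ℝ => x + t • e) 0 := by fun_prop
  have hc' : Tendsto (fun t : ℝ => x + t • e) (𝓝 0) (𝓝 x) := by simpa using hc.tendsto
  refine deriv_deriv_nonneg_of_isLocalMin ?_ ?_
  · have := hc'.eventually h
    simpa [IsLocalMin, IsMinFilter] using this
  · have : Tendsto (fun t : ℝ => f (x + t • e)) (𝓝 0) (𝓝 (f x)) :=
      hf.continuousAt.tendsto.comp hc'
    simpa [ContinuousAt] using this

theorem laplacian_norm_sub_sq (a x : E) :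
    Δ (fun y : E => ‖y - a‖ ^ 2) x = 2 * Module.finrank ℝ E := by
  have hf : ContDiffAt ℝ 2 (fun y : E => ‖y - a‖ ^ 2) x :=
    (contDiffAt_id.sub contDiffAt_const).norm_sq ℝ
  rw [laplacian_eq_sum_deriv_deriv (stdOrthonormalBasis ℝ E) hf]
  have key : ∀ i, deriv (deriv fun t : ℝ => ‖x + t • stdOrthonormalBasis ℝ E i - a‖ ^ 2) 0 = 2 := by
    intro i
    set e := stdOrthonormalBasis ℝ E i
    have he : ‖e‖ = 1 := (stdOrthonormalBasis ℝ E).orthonormal.1 i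
    have h1 : (fun t : ℝ => ‖x + t • e - a‖ ^ 2)
        = fun t : ℝ => ‖x - a‖ ^ 2 + 2 * t * ⟪x - a, e⟫ + t ^ 2 := by
      funext t
      rw [add_sub_right_comm, norm_add_smul_sq _ _ he]
    rw [h1]
    refine deriv_deriv_eq_of_eventually_hasDerivAt (g' := fun t => 2 * ⟪x - a, e⟫ + 2 * t)
      (Eventually.of_forall fun t => hasDerivAt_quadratic _ _ t) ?_
    simpa using ((hasDerivAt_id (0 : ℝ)).const_mul 2).const_add (2 * ⟪x - a, e⟫)
  simp [key, mul_comm]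

end Calculus

section Kelvin

variable {E : Type*} [NormedAddCommGroup E] [InnerProductSpace ℝ E]

/-- The Kelvin transform of `f` with respect to the sphere of centre `a` and radius `r`,
with weight exponent `m` (the classical one has `m = n - 2`). -/
noncomputable def kelvin (m : ℕ) (a : E) (r : ℝ) (f : E → ℝ) (y : E) : ℝ :=
  (r / ‖y - a‖) ^ m * f (inversion a r y)

theorem inversion_eq_add_smul (a : E) (r : ℝ) (y : E) :
    inversion a r y = a + (r ^ 2 * (‖y - a‖ ^ 2)⁻¹) • (y - a) := by
  rw [inversion, dist_eq_norm, div_pow, vsub_eq_sub, vadd_eq_add, add_comm, div_eq_mul_inv]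

omit [InnerProductSpace ℝ E] in
theorem div_norm_pow_eq_rpow (m : ℕ) (r : ℝ) (z : E) :
    (r / ‖z‖) ^ m = r ^ m * (‖z‖ ^ 2) ^ (-(m : ℝ) / 2) := by
  rw [div_pow, div_eq_mul_inv, ← Real.rpow_natCast ‖z‖ 2, ← Real.rpow_mul (norm_nonneg z),
    ← Real.rpow_natCast ‖z‖ m, ← Real.rpow_neg (norm_nonneg z)]
  congr 2
  push_cast
  ring

theorem deriv_deriv_kelvin_line (m : ℕ) (a : E) (r : ℝ) {f : E → ℝ} {y e : E} (hy : y ≠ a)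
    (hf : ContDiffAt ℝ 2 f (inversion a r y)) (he : ‖e‖ = 1) :
    deriv (deriv fun t : ℝ => kelvin m a r f (y + t • e)) 0 =
      (r / ‖y - a‖) ^ m *
        ((m * (m + 2) * ⟪y - a, e⟫ ^ 2 / (‖y - a‖ ^ 2) ^ 2 - m / ‖y - a‖ ^ 2)
            * f (inversion a r y)
          - 2 * m * ⟪y - a, e⟫ / ‖y - a‖ ^ 2 * (r ^ 2 / ‖y - a‖ ^ 2)
            * fderiv ℝ f (inversion a r y) (e - (2 * ⟪y - a, e⟫ / ‖y - a‖ ^ 2) • (y - a))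
          + (r / ‖y - a‖) ^ 4 * fderiv ℝ (fderiv ℝ f) (inversion a r y)
              (e - (2 * ⟪y - a, e⟫ / ‖y - a‖ ^ 2) • (y - a))
              (e - (2 * ⟪y - a, e⟫ / ‖y - a‖ ^ 2) • (y - a))
          + r ^ 2 * fderiv ℝ f (inversion a r y)
              ((8 * ⟪y - a, e⟫ ^ 2 / (‖y - a‖ ^ 2) ^ 3 - 2 / (‖y - a‖ ^ 2) ^ 2) • (y - a)
                - (4 * ⟪y - a, e⟫ / (‖y - a‖ ^ 2) ^ 2) • e)) := by
  set z := y - a with hz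
  set c := ⟪z, e⟫ with hc
  set q := ‖z‖ ^ 2 with hq
  have hz0 : z ≠ 0 := sub_ne_zero.2 hy
  have hq0 : 0 < q := by positivity
  clear_value q c z
  set N : ℝ → ℝ := fun t => q + 2 * t * c + t ^ 2 with hN
  have hN0 : N 0 = q := by simp [hN]
  have hNd : ∀ t, HasDerivAt N (2 * c + 2 * t) t := hasDerivAt_quadratic q c
  have hNd' : HasDerivAt (fun t : ℝ => 2 * c + 2 * t) 2 0 := by
    simpa using ((hasDerivAt_id (0 : ℝ)).const_mul 2).const_add (2 * c)
  have hNpos : ∀ᶠ t in 𝓝 (0 : ℝ), 0 < N t := by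
    have : ContinuousAt N 0 := (hNd 0).continuousAt
    exact this.eventually (lt_mem_nhds (by rw [hN0]; exact hq0))
  have hld : ∀ t : ℝ, HasDerivAt (fun t : ℝ => z + t • e) e t := fun t => by
    simpa using ((hasDerivAt_id t).smul_const e).const_add z
  set k : ℝ := -(m : ℝ) / 2 with hk
  -- the curve followed by the inverted point
  set γ : ℝ → E := fun t => a + (r ^ 2 * (N t)⁻¹) • (z + t • e) with hγdef
  set γ' : ℝ → E := fun t => (r ^ 2 * (N t)⁻¹) • e
    + (r ^ 2 * (-(2 * c + 2 * t) / N t ^ 2)) • (z + t • e) with hγ'def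
  have hγ : ∀ᶠ t in 𝓝 (0 : ℝ), HasDerivAt γ (γ' t) t := by
    filter_upwards [hNpos] with t ht
    exact ((((hNd t).inv ht.ne').const_mul (r ^ 2)).smul (hld t)).const_add a
  have hγ2 : HasDerivAt γ' ((r ^ 2) • ((8 * c ^ 2 / q ^ 3 - 2 / q ^ 2) • z
      - (4 * c / q ^ 2) • e)) 0 := by
    have h1 := (((hNd 0).inv (by rw [hN0]; exact hq0.ne')).const_mul (r ^ 2)).smul_const e
    have hN2 : N 0 ^ 2 ≠ 0 := by rw [hN0]; positivity
    have h2 := ((hNd'.neg.div ((hNd 0).pow 2) hN2).const_mul (r ^ 2)).smul (hld 0)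
    refine (h1.add h2).congr_deriv ?_
    simp only [hN0, mul_zero, add_zero, zero_smul, Pi.pow_apply, Pi.neg_apply, Pi.div_apply]
    match_scalars
    · field_simp
      ring
    · field_simp
      ring
  have hγ0 : γ 0 = inversion a r y := by
    rw [inversion_eq_add_smul]
    simp [hγdef, hN0, hq, hz]
  have hγ'0 : γ' 0 = (r ^ 2 / q) • (e - (2 * c / q) • z) := by
    simp only [hγ'def, hN0, mul_zero, add_zero, zero_smul]
    match_scalars
    · field_simp
    · field_simp
  have hf0 : ContDiffAt ℝ 2 f (γ 0) := by rwa [hγ0]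
  have F1 := eventually_hasDerivAt_comp_curve hf0 hγ
  have F2 := hasDerivAt_fderiv_apply_curve hf0 hγ.self_of_nhds hγ2
  -- the conformal weight
  set w : ℝ → ℝ := fun t => N t ^ k with hw
  set w' : ℝ → ℝ := fun t => (2 * c + 2 * t) * k * N t ^ (k - 1) with hw'
  have hwd : ∀ᶠ t in 𝓝 (0 : ℝ), HasDerivAt w (w' t) t := by
    filter_upwards [hNpos] with t ht
    exact (hNd t).rpow_const (Or.inl ht.ne')
  have hwd2 : HasDerivAt w' (2 * k * q ^ (k - 1)
      + 2 * c * k * (2 * c * (k - 1) * q ^ (k - 1 - 1))) 0 := by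
    have := (hNd'.mul_const k).mul ((hNd 0).rpow_const (p := k - 1)
      (Or.inl (by rw [hN0]; exact hq0.ne')))
    refine this.congr_deriv ?_
    simp [hN0]
  have hfun : (fun t : ℝ => kelvin m a r f (y + t • e))
      = fun t => r ^ m * (w t * f (γ t)) := by
    funext t
    have h1 : y + t • e - a = z + t • e := by rw [hz]; abel
    rw [kelvin, inversion_eq_add_smul, h1, div_norm_pow_eq_rpow, norm_add_smul_sq z e he,
      ← hq, ← hc, ← hk]
    exact mul_assoc _ _ _
  have hD1 : ∀ᶠ t in 𝓝 (0 : ℝ), HasDerivAt (fun t => r ^ m * (w t * f (γ t)))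
      (r ^ m * (w' t * f (γ t) + w t * fderiv ℝ f (γ t) (γ' t))) t := by
    filter_upwards [hwd, F1] with t h1 h2
    exact (h1.mul h2).const_mul _
  have hD2 := ((hwd2.mul F1.self_of_nhds).add (hwd.self_of_nhds.mul F2)).const_mul (r ^ m)
  rw [hfun, deriv_deriv_eq_of_eventually_hasDerivAt hD1 hD2]
  have hp1 : q ^ (k - 1) = q ^ k / q := Real.rpow_sub_one hq0.ne' k
  have hp2 : q ^ (k - 1 - 1) = q ^ k / q / q := by rw [Real.rpow_sub_one hq0.ne', hp1]
  have h4 : (r / ‖z‖) ^ 4 = (r ^ 2 / q) ^ 2 := by rw [hq]; ring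
  rw [hγ0, hγ'0, h4, div_norm_pow_eq_rpow]
  simp only [hw, hw', hN0, hp1, hp2, map_smul, smul_apply, smul_eq_mul]
  rw [← hq, ← hk]
  have hk' : (m : ℝ) = -2 * k := by rw [hk]; ring
  rw [hk']
  generalize fderiv ℝ f (inversion a r y) (e - (2 * c / q) • z) = A
  generalize fderiv ℝ (fderiv ℝ f) (inversion a r y) (e - (2 * c / q) • z)
    (e - (2 * c / q) • z) = B
  generalize q ^ k = Q
  field_simp
  ring

theorem contDiffAt_kelvin (m : ℕ) {a : E} (r : ℝ) {f : E → ℝ} {y : E} (hy : y ≠ a)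
    (hf : ContDiffAt ℝ 2 f (inversion a r y)) : ContDiffAt ℝ 2 (kelvin m a r f) y := by
  have h1 : ContDiffAt ℝ 2 (fun y => inversion a r y) y :=
    contDiffAt_const.inversion contDiffAt_const contDiffAt_id hy
  have h2 : ContDiffAt ℝ 2 (fun y : E => ‖y - a‖) y :=
    (contDiffAt_id.sub contDiffAt_const).norm ℝ (sub_ne_zero.2 hy)
  exact ((contDiffAt_const.div h2 (norm_ne_zero_iff.2 (sub_ne_zero.2 hy))).pow m).mul
    (hf.comp y h1)

variable [FiniteDimensional ℝ E]

/-- The Kelvin transform intertwines the Laplacian up to a conformal factor. -/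
theorem laplacian_kelvin {m : ℕ} (hm : Module.finrank ℝ E = m + 2) {a : E} (r : ℝ) {f : E → ℝ}
    {y : E} (hy : y ≠ a) (hf : ContDiffAt ℝ 2 f (inversion a r y)) :
    Δ (kelvin m a r f) y = (r / ‖y - a‖) ^ (m + 4) * Δ f (inversion a r y) := by
  set b := stdOrthonormalBasis ℝ E with hb
  have hb1 : ∀ i, ‖b i‖ = 1 := b.orthonormal.1
  rw [laplacian_eq_sum_deriv_deriv b (contDiffAt_kelvin m r hy hf)]
  simp_rw [fun i => deriv_deriv_kelvin_line m a r hy hf (hb1 i)]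
  set z := y - a with hz
  have hz0 : z ≠ 0 := sub_ne_zero.2 hy
  set q := ‖z‖ ^ 2 with hq
  have hq0 : 0 < q := by positivity
  set L := fderiv ℝ f (inversion a r y)
  set B := fderiv ℝ (fderiv ℝ f) (inversion a r y)
  have hlap : Δ f (inversion a r y) =
      ∑ i, B (b i - (2 * ⟪z, b i⟫ / q) • z) (b i - (2 * ⟪z, b i⟫ / q) • z) := by
    rw [laplacian_eq_sum_fderiv (b.map (ℝ ∙ z).reflection)]
    refine Finset.sum_congr rfl fun i _ => ?_
    have : (b.map (ℝ ∙ z).reflection) i = -(b i - (2 * ⟪z, b i⟫ / q) • z) := by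
      rw [OrthonormalBasis.map_apply, Submodule.reflection_singleton_apply]
      simp only [RCLike.ofReal_real_eq_id, id_eq, ← hq]
      module
    rw [this]
    simp [B]
    ring
  have hS1 : ∑ i, ⟪z, b i⟫ ^ 2 = q := b.sum_sq_inner_left z
  have hS2 : ∑ i, ⟪z, b i⟫ * L (b i) = L z := by
    conv_rhs => rw [← b.sum_repr' z, map_sum]
    simp [real_inner_comm]
  have hcard : ∑ _i : Fin (Module.finrank ℝ E), (1 : ℝ) = m + 2 := by simp [hm]
  rw [hlap, ← Finset.mul_sum]
  simp only [map_sub, map_smul, smul_eq_mul]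
  have expand : ∀ i, ((m * (m + 2) * ⟪z, b i⟫ ^ 2 / q ^ 2 - m / q) * f (inversion a r y)
          - 2 * m * ⟪z, b i⟫ / q * (r ^ 2 / q) * (L (b i) - 2 * ⟪z, b i⟫ / q * L z)
          + (r / ‖z‖) ^ 4 * B (b i - (2 * ⟪z, b i⟫ / q) • z) (b i - (2 * ⟪z, b i⟫ / q) • z)
          + r ^ 2 * ((8 * ⟪z, b i⟫ ^ 2 / q ^ 3 - 2 / q ^ 2) * L z - 4 * ⟪z, b i⟫ / q ^ 2 * L (b i)))
      = (m * (m + 2) / q ^ 2 * f (inversion a r y) + (4 * m / q ^ 3 + 8 / q ^ 3) * r ^ 2 * L z)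
            * ⟪z, b i⟫ ^ 2
          + (-m / q * f (inversion a r y) - 2 / q ^ 2 * r ^ 2 * L z) * 1
          + (-2 * m / q ^ 2 - 4 / q ^ 2) * r ^ 2 * (⟪z, b i⟫ * L (b i))
          + (r / ‖z‖) ^ 4 *
            B (b i - (2 * ⟪z, b i⟫ / q) • z) (b i - (2 * ⟪z, b i⟫ / q) • z) := by
    intro i
    field_simp
    ring
  simp only [map_sub, map_smul, smul_eq_mul] at expand ⊢
  simp_rw [expand, Finset.sum_add_distrib, ← Finset.mul_sum, hS1, hS2, hcard, pow_add, mul_assoc]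
  rw [← add_zero ((r / ‖z‖) ^ m * ((r / ‖z‖) ^ 4 * _)), ← mul_zero ((r / ‖z‖) ^ m), ← mul_add]
  congr 1
  rw [add_comm]
  congr 1
  field_simp
  ring

end Kelvin

section MinimumPrinciple

variable {E : Type*} [NormedAddCommGroup E] [InnerProductSpace ℝ E] [FiniteDimensional ℝ E]

omit [InnerProductSpace ℝ E] [FiniteDimensional ℝ E] in
theorem exists_isLocalMin_of_lt_on_annulus [ProperSpace E] {g : E → ℝ} {a y₀ : E} {s ρ c : ℝ}
    (hg : ContinuousOn g {y | s ≤ ‖y - a‖ ∧ ‖y - a‖ ≤ ρ})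
    (hin : ∀ y, ‖y - a‖ = s → c ≤ g y) (hout : ∀ y, ‖y - a‖ = ρ → c ≤ g y)
    (hy₀ : s ≤ ‖y₀ - a‖ ∧ ‖y₀ - a‖ ≤ ρ) (hlt : g y₀ < c) :
    ∃ y, s < ‖y - a‖ ∧ ‖y - a‖ < ρ ∧ IsLocalMin g y ∧ g y < c := by
  have hcont : Continuous fun y : E => ‖y - a‖ := by fun_prop
  have hK : IsCompact {y : E | s ≤ ‖y - a‖ ∧ ‖y - a‖ ≤ ρ} := by
    refine (isCompact_closedBall a ρ).of_isClosed_subset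
      ((isClosed_le continuous_const hcont).inter (isClosed_le hcont continuous_const)) ?_
    intro y hy
    simpa [dist_eq_norm] using hy.2
  obtain ⟨y, hy, hmin⟩ := hK.exists_isMinOn ⟨y₀, hy₀⟩ hg
  have hyc : g y < c := (hmin hy₀).trans_lt hlt
  have h1 : s < ‖y - a‖ := lt_of_le_of_ne hy.1 fun h => hyc.not_ge (hin y h.symm)
  have h2 : ‖y - a‖ < ρ := lt_of_le_of_ne hy.2 fun h => hyc.not_ge (hout y h)
  refine ⟨y, h1, h2, hmin.isLocalMin ?_, hyc⟩
  filter_upwards [hcont.continuousAt.eventually (lt_mem_nhds h1),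
    hcont.continuousAt.eventually (gt_mem_nhds h2)] with x hx1 hx2 using ⟨hx1.le, hx2.le⟩

/-- An isolated singularity does not spoil the minimum principle for a strictly superharmonic
function which is bounded from below. -/
theorem le_of_laplacian_neg_punctured_ball {m : ℕ} (hm : Module.finrank ℝ E = m + 2)
    (hm1 : 1 ≤ m) {f : E → ℝ} {a : E} {ρ η : ℝ}
    (hf : ∀ y, y ≠ a → ContDiffAt ℝ 2 f y)
    (hlap : ∀ y, y ≠ a → ‖y - a‖ < ρ → Δ f y < 0)
    (hpos : ∀ y, y ≠ a → ‖y - a‖ < ρ → 0 ≤ f y)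
    (hη : ∀ y, ‖y - a‖ = ρ → η ≤ f y) {y₀ : E} (hy₀ : y₀ ≠ a) (hy₀ρ : ‖y₀ - a‖ ≤ ρ) :
    η ≤ f y₀ := by
  have hr0 : 0 < ‖y₀ - a‖ := norm_pos_iff.2 (sub_ne_zero.2 hy₀)
  set Γ : E → ℝ := kelvin m a 1 fun _ => 1 with hΓ
  have hΓval : ∀ y, Γ y = (‖y - a‖⁻¹) ^ m := fun y => by simp [hΓ, kelvin]
  have hΓpos : ∀ y, 0 ≤ Γ y := fun y => by rw [hΓval]; positivity
  have hΓc : ∀ y, y ≠ a → ContDiffAt ℝ 2 Γ y := fun y hy =>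
    contDiffAt_kelvin m 1 hy contDiffAt_const
  have hΓl : ∀ y, y ≠ a → Δ Γ y = 0 := fun y hy => by
    rw [hΓ, laplacian_kelvin hm 1 hy contDiffAt_const]
    simp
  have main : ∀ ε > 0, η ≤ f y₀ + ε * Γ y₀ := by
    intro ε hε
    by_contra! hlt
    have htend : Tendsto (fun s : ℝ => ε * (s⁻¹) ^ m) (𝓝[>] 0) atTop :=
      ((tendsto_pow_atTop (by omega)).comp tendsto_inv_nhdsGT_zero).const_mul_atTop hε
    obtain ⟨s, hs, hs0, hs1⟩ := ((htend.eventually_ge_atTop η).and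
      (Ioo_mem_nhdsGT (lt_min hr0 (hr0.trans_le hy₀ρ)))).exists
    have hsρ : s < ρ := hs1.trans_le (min_le_right _ _)
    have hne : ∀ y, s ≤ ‖y - a‖ → y ≠ a := by
      rintro y hy rfl
      simp at hy
      linarith
    obtain ⟨y, hy1, hy2, hmin, -⟩ := exists_isLocalMin_of_lt_on_annulus
      (g := f + ε • Γ) (a := a) (s := s) (ρ := ρ) (c := η) (y₀ := y₀)
      (fun y hy => ((hf y (hne y hy.1)).add
        (contDiffAt_const.smul (hΓc y (hne y hy.1)))).continuousAt.continuousWithinAt)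
      (fun y hy => by
        have h1 := hpos y (hne y hy.ge) (hy.trans_lt hsρ)
        have h2 : ε * Γ y = ε * (s⁻¹) ^ m := by rw [hΓval, hy]
        simp only [Pi.add_apply, Pi.smul_apply, smul_eq_mul]
        linarith)
      (fun y hy => by
        have h1 := hη y hy
        have h2 := mul_nonneg hε.le (hΓpos y)
        simp only [Pi.add_apply, Pi.smul_apply, smul_eq_mul]
        linarith)
      ⟨(hs1.trans_le (min_le_left _ _)).le, hy₀ρ⟩ (by simpa using hlt)
    have hya := hne y hy1.le
    have hc : ContDiffAt ℝ 2 (ε • Γ) y := contDiffAt_const.smul (hΓc y hya)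
    have := laplacian_nonneg_of_isLocalMin hmin ((hf y hya).add hc)
    rw [(hf y hya).laplacian_add hc, laplacian_smul ε (hΓc y hya), hΓl y hya] at this
    have h3 := hlap y hya hy2
    simp at this
    linarith
  have hlim : Tendsto (fun ε : ℝ => f y₀ + ε * Γ y₀) (𝓝[>] 0) (𝓝 (f y₀ + 0 * Γ y₀)) := by
    refine Tendsto.mono_left ?_ nhdsWithin_le_nhds
    exact (Continuous.tendsto (by fun_prop) 0)
  rw [zero_mul, add_zero] at hlim
  exact ge_of_tendsto hlim (eventually_mem_nhdsWithin.mono main)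

end MinimumPrinciple

section Matukuma

variable {E : Type*} [NormedAddCommGroup E] [InnerProductSpace ℝ E]

theorem norm_inversion_norm {a y : E} (ha : a ≠ 0) (hy : y ≠ a) :
    ‖inversion a ‖a‖ y‖ = ‖a‖ / ‖y - a‖ * ‖y‖ := by
  have h0 : inversion a ‖a‖ (0 : E) = 0 := by
    simpa using inversion_dist_center' a (0 : E)
  have h := dist_inversion_inversion hy ha.symm ‖a‖
  rw [h0, dist_zero_right, dist_zero_right, dist_zero_left, dist_eq_norm] at h
  have h1 : ‖a‖ ≠ 0 := norm_ne_zero_iff.2 ha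
  have h2 : ‖y - a‖ ≠ 0 := norm_ne_zero_iff.2 (sub_ne_zero.2 hy)
  rw [h]
  field_simp

theorem norm_pow_mul_kelvin (m : ℕ) {a y : E} (ha : a ≠ 0) (hy : y ≠ a) (u : E → ℝ) :
    ‖y‖ ^ m * kelvin m a ‖a‖ u y =
      ‖inversion a ‖a‖ y‖ ^ m * u (inversion a ‖a‖ y) := by
  rw [norm_inversion_norm ha hy, kelvin]
  ring

theorem tendsto_inversion_cobounded (a : E) {r : ℝ} (hr : r ≠ 0) :
    Tendsto (inversion a r) (Bornology.cobounded E) (𝓝[≠] a) := by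
  refine tendsto_nhdsWithin_iff.2 ⟨?_, ?_⟩
  · rw [tendsto_iff_dist_tendsto_zero]
    simp_rw [dist_inversion_center]
    exact (Metric.tendsto_dist_right_cobounded_atTop a).const_div_atTop _
  · filter_upwards [Bornology.eventually_ne_cobounded a] with z hz
    simpa [inversion_eq_center hr] using hz

theorem continuousAt_kelvin_norm (m : ℕ) {u : E → ℝ} (hu : Continuous u) {a y : E}
    (hy : y ≠ a) : ContinuousAt (fun q : E × E => kelvin m q.1 ‖q.1‖ u q.2) (a, y) := by
  have h1 : ContinuousAt (fun q : E × E => inversion q.1 ‖q.1‖ q.2) (a, y) :=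
    ContinuousAt.inversion continuousAt_fst continuousAt_fst.norm continuousAt_snd hy
  have h2 : ‖y - a‖ ≠ 0 := norm_ne_zero_iff.2 (sub_ne_zero.2 hy)
  exact ((continuousAt_fst.norm.div (continuousAt_snd.sub continuousAt_fst).norm h2).pow m).mul
    (hu.continuousAt.comp h1)

theorem rpow_sub_rpow_le {p s t : ℝ} (hp : 1 ≤ p) (hs : 0 < s) (ht : 0 < t) :
    s ^ p - t ^ p ≤ p * s ^ (p - 1) * (s - t) := by
  have h := one_add_mul_self_le_rpow_one_add (s := t / s - 1)
    (by have := div_pos ht hs; linarith) hp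
  rw [add_sub_cancel, Real.div_rpow ht.le hs.le, le_div_iff₀ (Real.rpow_pos_of_pos hs p)] at h
  have h1 : s ^ p = s ^ (p - 1) * s := by
    rw [← Real.rpow_add_one hs.ne', sub_add_cancel]
  have h2 : (1 + p * (t / s - 1)) * s ^ p = s ^ p + p * s ^ (p - 1) * (t - s) := by
    rw [h1]
    field_simp
  linarith

/-- In the ball bounded by the sphere centred at `a` through the origin, `u` lies below its
Kelvin transform. -/
def KelvinDominates (m : ℕ) (u : E → ℝ) (a : E) : Prop :=
  ∀ y, y ≠ a → ‖y - a‖ < ‖a‖ → u y ≤ kelvin m a ‖a‖ u y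

variable [FiniteDimensional ℝ E]

/-- Positive entire solutions of the Matukuma equation `-Δ u = u ^ p / (1 + |x| ^ 2)`. -/
structure IsMatukumaSolution (p : ℝ) (u : E → ℝ) : Prop where
  contDiff : ContDiff ℝ 2 u
  pos : ∀ x, 0 < u x
  laplacian_eq : ∀ x, Δ u x = -(u x ^ p / (1 + ‖x‖ ^ 2))

namespace IsMatukumaSolution

variable {p : ℝ} {u : E → ℝ} {m : ℕ} {a y : E}

theorem kelvin_pos (hu : IsMatukumaSolution p u) {r : ℝ} (hr : 0 < r) (hy : y ≠ a) :
    0 < kelvin m a r u y := by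
  have := hu.pos (inversion a r y)
  have h2 : 0 < ‖y - a‖ := norm_pos_iff.2 (sub_ne_zero.2 hy)
  unfold kelvin
  positivity

theorem contDiffAt_kelvin (hu : IsMatukumaSolution p u) (m : ℕ) (r : ℝ) (hy : y ≠ a) :
    ContDiffAt ℝ 2 (kelvin m a r u) y :=
  _root_.contDiffAt_kelvin m r hy hu.contDiff.contDiffAt

theorem laplacian_neg (hu : IsMatukumaSolution p u) (x : E) : Δ u x < 0 := by
  rw [hu.laplacian_eq]
  have := Real.rpow_pos_of_pos (hu.pos x) p
  have : 0 < u x ^ p / (1 + ‖x‖ ^ 2) := by positivity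
  linarith

theorem laplacian_kelvin_lt (hu : IsMatukumaSolution p u) (hm : Module.finrank ℝ E = m + 2)
    (hpm : p * m ≤ m + 2) (hy : y ≠ a) (hya : ‖y - a‖ < ‖a‖) :
    Δ (kelvin m a ‖a‖ u) y < -(kelvin m a ‖a‖ u y ^ p / (1 + ‖y‖ ^ 2)) := by
  have hd : 0 < ‖y - a‖ := norm_pos_iff.2 (sub_ne_zero.2 hy)
  have ha : a ≠ 0 := norm_pos_iff.1 (hd.trans hya)
  rw [laplacian_kelvin hm ‖a‖ hy hu.contDiff.contDiffAt, hu.laplacian_eq,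
    norm_inversion_norm ha hy, kelvin]
  set t := ‖a‖ / ‖y - a‖ with ht
  have ht1 : 1 < t := (one_lt_div hd).2 hya
  have ht0 : 0 < t := by linarith
  set U := u (inversion a ‖a‖ y)
  have hU : 0 < U := hu.pos _
  have hUp : 0 < U ^ p := Real.rpow_pos_of_pos hU p
  have h1 : (t ^ m * U) ^ p ≤ t ^ (m + 2) * U ^ p := by
    rw [Real.mul_rpow (by positivity) hU.le, ← Real.rpow_natCast t m, ← Real.rpow_mul ht0.le,
      ← Real.rpow_natCast t (m + 2)]
    refine mul_le_mul_of_nonneg_right (Real.rpow_le_rpow_of_exponent_le ht1.le ?_) hUp.le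
    push_cast
    linarith
  have h2 : t ^ (m + 2) * U ^ p / (1 + ‖y‖ ^ 2) <
      t ^ (m + 4) * (U ^ p / (1 + (t * ‖y‖) ^ 2)) := by
    have h3 : 1 + (t * ‖y‖) ^ 2 < t ^ 2 * (1 + ‖y‖ ^ 2) := by nlinarith
    rw [← mul_div_assoc, div_lt_div_iff₀ (by positivity) (by positivity)]
    calc t ^ (m + 2) * U ^ p * (1 + (t * ‖y‖) ^ 2)
        < t ^ (m + 2) * U ^ p * (t ^ 2 * (1 + ‖y‖ ^ 2)) :=
          mul_lt_mul_of_pos_left h3 (by positivity)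
      _ = t ^ (m + 4) * U ^ p * (1 + ‖y‖ ^ 2) := by ring
  have h4 : (t ^ m * U) ^ p / (1 + ‖y‖ ^ 2) ≤ t ^ (m + 2) * U ^ p / (1 + ‖y‖ ^ 2) := by gcongr
  linarith

theorem laplacian_kelvin_sub_lt (hu : IsMatukumaSolution p u) (hm : Module.finrank ℝ E = m + 2)
    (hpm : p * m ≤ m + 2) (hy : y ≠ a) (hya : ‖y - a‖ < ‖a‖) :
    Δ (kelvin m a ‖a‖ u - u) y < (u y ^ p - kelvin m a ‖a‖ u y ^ p) / (1 + ‖y‖ ^ 2) := by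
  rw [(hu.contDiffAt_kelvin m ‖a‖ hy).laplacian_sub hu.contDiff.contDiffAt, hu.laplacian_eq,
    sub_div]
  have := hu.laplacian_kelvin_lt hm hpm hy hya
  linarith

theorem laplacian_kelvin_sub_neg (hu : IsMatukumaSolution p u)
    (hm : Module.finrank ℝ E = m + 2) (hp : 1 ≤ p) (hpm : p * m ≤ m + 2) (hy : y ≠ a)
    (hya : ‖y - a‖ < ‖a‖) (hle : u y ≤ kelvin m a ‖a‖ u y) :
    Δ (kelvin m a ‖a‖ u - u) y < 0 := by
  refine (hu.laplacian_kelvin_sub_lt hm hpm hy hya).trans_le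
    (div_nonpos_of_nonpos_of_nonneg ?_ (by positivity))
  exact sub_nonpos.2 (Real.rpow_le_rpow (hu.pos y).le hle (by linarith))

theorem lt_kelvin (hu : IsMatukumaSolution p u) (hm : Module.finrank ℝ E = m + 2)
    (hp : 1 ≤ p) (hpm : p * m ≤ m + 2) (h : KelvinDominates m u a) (hy : y ≠ a)
    (hya : ‖y - a‖ < ‖a‖) : u y < kelvin m a ‖a‖ u y := by
  refine lt_of_le_of_ne (h y hy hya) fun heq => ?_
  have h1 := hu.laplacian_kelvin_sub_neg hm hp hpm hy hya heq.le
  have hmin : IsLocalMin (kelvin m a ‖a‖ u - u) y := by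
    have hc : ContinuousAt (fun x : E => ‖x - a‖) y := by fun_prop
    filter_upwards [hc.eventually (gt_mem_nhds hya), eventually_ne_nhds hy] with x hx hxa
    have := h x hxa hx
    simp only [Pi.sub_apply]
    linarith
  have h2 := laplacian_nonneg_of_isLocalMin hmin
    ((hu.contDiffAt_kelvin m ‖a‖ hy).sub hu.contDiff.contDiffAt)
  linarith

theorem exists_kelvin_lt_of_not_kelvinDominates (hu : IsMatukumaSolution p u)
    (hm : Module.finrank ℝ E = m + 2) (hp : 1 ≤ p) (hpm : p * m ≤ m + 2) {C ε : ℝ}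
    (hC : ∀ y, ‖y - a‖ < ‖a‖ → p * u y ^ (p - 1) ≤ C) (hε : 0 < ε) (hCε : C * ε ≤ m + 2)
    (hnear : ∀ᶠ y in 𝓝[≠] a, u y ≤ kelvin m a ‖a‖ u y) (hnot : ¬ KelvinDominates m u a) :
    ∃ y, y ≠ a ∧ ‖y - a‖ ^ 2 ≤ ‖a‖ ^ 2 - ε ∧ kelvin m a ‖a‖ u y < u y := by
  simp only [KelvinDominates, not_forall, not_le] at hnot
  obtain ⟨y₀, hy₀a, hy₀, hlt₀⟩ := hnot
  obtain ⟨s₁, hs₁, hs₁'⟩ := Metric.eventually_nhds_iff.1 (eventually_nhdsWithin_iff.1 hnear)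
  have hd₀ : 0 < ‖y₀ - a‖ := norm_pos_iff.2 (sub_ne_zero.2 hy₀a)
  obtain ⟨s, hs0, hs⟩ := exists_between (lt_min hs₁ hd₀)
  have hne : ∀ y, s ≤ ‖y - a‖ → y ≠ a := by
    rintro y hy rfl
    simp at hy
    linarith
  set φ : E → ℝ := fun y => ‖a‖ ^ 2 + ε - ‖y - a‖ ^ 2 with hφ
  set w : E → ℝ := kelvin m a ‖a‖ u - u with hw
  have hφpos : ∀ y, ‖y - a‖ ≤ ‖a‖ → 0 < φ y := fun y hy => by
    have := pow_le_pow_left₀ (norm_nonneg _) hy 2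
    simp only [hφ]
    linarith
  have hsq : ∀ y, ContDiffAt ℝ 2 (fun y : E => ‖y - a‖ ^ 2) y := fun y =>
    (contDiffAt_id.sub contDiffAt_const).norm_sq ℝ
  have hφc : ∀ y, ContDiffAt ℝ 2 φ y := fun y => contDiffAt_const.sub (hsq y)
  have hwc : ∀ y, y ≠ a → ContDiffAt ℝ 2 w y := fun y hy =>
    (hu.contDiffAt_kelvin m ‖a‖ hy).sub hu.contDiff.contDiffAt
  have hφl : ∀ y, Δ φ y = -(2 * (m + 2)) := fun y => by
    have h1 : φ = (fun _ => ‖a‖ ^ 2 + ε) - fun y => ‖y - a‖ ^ 2 := rfl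
    rw [h1, contDiffAt_const.laplacian_sub (hsq y), laplacian_const, laplacian_norm_sub_sq, hm]
    simp
  obtain ⟨y, hy1, hy2, hmin, hneg⟩ := exists_isLocalMin_of_lt_on_annulus
    (g := fun y => w y / φ y) (a := a) (s := s) (ρ := ‖a‖) (c := 0) (y₀ := y₀)
    (fun y hy => ((hwc y (hne y hy.1)).continuousAt.div (hφc y).continuousAt
      (hφpos y hy.2).ne').continuousWithinAt)
    (fun y hy => by
      have hs_lt : s < ‖a‖ := (hs.trans_le (min_le_right _ _)).trans hy₀
      refine div_nonneg ?_ (hφpos y (hy.trans_le hs_lt.le)).le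
      refine sub_nonneg.2 (hs₁' ?_ (hne y hy.ge))
      rw [dist_eq_norm, hy]
      exact hs.trans_le (min_le_left _ _))
    (fun y hy => by
      refine div_nonneg ?_ (hφpos y hy.le).le
      have h1 : y ∈ Metric.sphere a ‖a‖ := by simpa [dist_eq_norm] using hy
      have h2 : ‖a‖ ≠ 0 := by linarith
      simp [hw, kelvin, hy, inversion_of_mem_sphere h1, div_self h2])
    ⟨(hs.trans_le (min_le_right _ _)).le, hy₀.le⟩
    (div_neg_of_neg_of_pos (sub_neg.2 hlt₀) (hφpos y₀ hy₀.le))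
  have hya := hne y hy1.le
  have hφy := hφpos y hy2.le
  have hwneg : w y < 0 := by
    by_contra! h
    exact absurd hneg (not_lt.2 (div_nonneg h hφy.le))
  have hlt : kelvin m a ‖a‖ u y < u y := sub_neg.1 hwneg
  refine ⟨y, hya, ?_, hlt⟩
  by_contra! hshell
  set M := -(w y / φ y) with hM
  have hMpos : 0 < M := neg_pos.2 hneg
  have hwM : w y = -(M * φ y) := by rw [hM]; field_simp
  have hmin' : IsLocalMin (w + M • φ) y := by
    have hc : ContinuousAt (fun x : E => ‖x - a‖) y := by fun_prop
    filter_upwards [hmin, hc.eventually (gt_mem_nhds hy2)] with x hx hxa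
    have hφx := hφpos x hxa.le
    have h1 : -M ≤ w x / φ x := by rw [hM, neg_neg]; exact hx
    rw [le_div_iff₀ hφx] at h1
    simp only [Pi.add_apply, Pi.smul_apply, smul_eq_mul]
    linarith
  have hcs : ContDiffAt ℝ 2 (M • φ) y := contDiffAt_const.smul (hφc y)
  have h1 := laplacian_nonneg_of_isLocalMin hmin' ((hwc y hya).add hcs)
  rw [(hwc y hya).laplacian_add hcs, laplacian_smul M (hφc y), hφl, smul_eq_mul] at h1
  have h2 : Δ w y < _ := hu.laplacian_kelvin_sub_lt hm hpm hya hy2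
  have h3 : (u y ^ p - kelvin m a ‖a‖ u y ^ p) / (1 + ‖y‖ ^ 2) ≤ C * (M * φ y) := by
    have hk := hu.kelvin_pos (m := m) (hd₀.trans hy₀) hya
    have h4 := rpow_sub_rpow_le hp (hu.pos y) hk
    have h5 : u y - kelvin m a ‖a‖ u y = M * φ y := by
      have : w y = kelvin m a ‖a‖ u y - u y := rfl
      linarith
    rw [h5] at h4
    have h6 := mul_le_mul_of_nonneg_right (hC y hy2) (mul_pos hMpos hφy).le
    have h7 : 0 ≤ u y ^ p - kelvin m a ‖a‖ u y ^ p :=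
      sub_nonneg.2 (Real.rpow_le_rpow hk.le hlt.le (by linarith))
    exact (div_le_self h7 (by nlinarith [sq_nonneg ‖y‖])).trans (h4.trans h6)
  have hC0 : 0 < C :=
    (mul_pos (by linarith) (Real.rpow_pos_of_pos (hu.pos y) (p - 1))).trans_le (hC y hy2)
  have hφ2 : φ y < 2 * ε := by simp only [hφ]; linarith
  have h8 : C * φ y < 2 * (m + 2) := by nlinarith
  have h9 := mul_lt_mul_of_pos_left h8 hMpos
  linarith

theorem exists_le_norm_pow_mul (hu : IsMatukumaSolution p u)
    (hm : Module.finrank ℝ E = m + 2) (hm1 : 1 ≤ m) :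
    ∃ c > 0, ∀ z, 1 ≤ ‖z‖ → c ≤ ‖z‖ ^ m * u z := by
  obtain ⟨c, hc, hcu⟩ := (isCompact_sphere (0 : E) 1).exists_forall_le'
    hu.contDiff.continuous.continuousOn (a := 0) fun x _ => hu.pos x
  refine ⟨c, hc, fun z hz => ?_⟩
  have hz0 : z ≠ 0 := norm_pos_iff.1 (by linarith)
  have hy : ‖inversion (0 : E) 1 z‖ = 1 / ‖z‖ := by
    simpa using dist_inversion_center (0 : E) z 1
  have hy0 : inversion (0 : E) 1 z ≠ 0 := by
    rw [← norm_pos_iff, hy]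
    positivity
  have h := le_of_laplacian_neg_punctured_ball hm hm1 (f := kelvin m 0 1 u) (a := 0) (ρ := 1)
    (η := c) (fun y hy => hu.contDiffAt_kelvin m 1 hy)
    (fun y hy _ => by
      rw [laplacian_kelvin hm 1 hy hu.contDiff.contDiffAt]
      have : 0 < ‖y - 0‖ := norm_pos_iff.2 (sub_ne_zero.2 hy)
      exact mul_neg_of_pos_of_neg (by positivity) (hu.laplacian_neg _))
    (fun y hy _ => (hu.kelvin_pos one_pos hy).le)
    (fun y hy => by
      have h1 : y ∈ Metric.sphere (0 : E) 1 := by simpa using hy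
      rw [sub_zero] at hy
      simpa [kelvin, hy, inversion_of_mem_sphere h1] using hcu y h1)
    hy0 (by rw [sub_zero, hy]; exact div_le_one_of_le₀ hz (norm_nonneg z))
  rwa [kelvin, inversion_inversion 0 one_ne_zero, sub_zero, hy, one_div_one_div] at h

theorem exists_lt_forall_eventually_le (hu : IsMatukumaSolution p u)
    (hm : Module.finrank ℝ E = m + 2) (hm1 : 1 ≤ m) (hp : 1 ≤ p) (hpm : p * m ≤ m + 2)
    (ha : a ≠ 0) (h : KelvinDominates m u a) :
    ∃ A > ‖a‖ ^ m * u a, ∀ᶠ z in Bornology.cobounded E, A ≤ ‖z‖ ^ m * u z := by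
  have ha' : 0 < ‖a‖ := norm_pos_iff.2 ha
  have hc : ∀ y, y ≠ a → ContDiffAt ℝ 2 (kelvin m a ‖a‖ u - u) y := fun y hy =>
    (hu.contDiffAt_kelvin m ‖a‖ hy).sub hu.contDiff.contDiffAt
  have hsph : ∀ y, ‖y - a‖ = ‖a‖ / 2 → y ≠ a := by
    rintro y hy rfl
    simp at hy
    linarith
  obtain ⟨η, hη, hηu⟩ := (isCompact_sphere a (‖a‖ / 2)).exists_forall_le'
    (f := kelvin m a ‖a‖ u - u) (a := 0)
    (fun y hy => (hc y (hsph y (by simpa [dist_eq_norm] using hy))).continuousAt.continuousWithinAt)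
    (fun y hy => by
      have hy' : ‖y - a‖ = ‖a‖ / 2 := by simpa [dist_eq_norm] using hy
      exact sub_pos.2 (hu.lt_kelvin hm hp hpm h (hsph y hy') (by linarith)))
  have hmin : ∀ y, y ≠ a → ‖y - a‖ ≤ ‖a‖ / 2 → η ≤ (kelvin m a ‖a‖ u - u) y := fun y hy hya =>
    le_of_laplacian_neg_punctured_ball hm hm1 hc
      (fun y hy hya => hu.laplacian_kelvin_sub_neg hm hp hpm hy (by linarith)
        (h y hy (by linarith)))
      (fun y hy hya => sub_nonneg.2 (h y hy (by linarith)))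
      (fun y hy => hηu y (by simpa [dist_eq_norm] using hy)) hy hya
  refine ⟨‖a‖ ^ m * (u a + η / 2), by gcongr; linarith, ?_⟩
  have hcont : ContinuousAt (fun y : E => ‖y‖ ^ m * (u y + η)) a := by
    have := hu.contDiff.continuous
    fun_prop
  have hlt : ‖a‖ ^ m * (u a + η / 2) < ‖a‖ ^ m * (u a + η) := by gcongr; linarith
  have hev : ∀ᶠ y in 𝓝[≠] a,
      ‖a‖ ^ m * (u a + η / 2) ≤ ‖inversion a ‖a‖ y‖ ^ m * u (inversion a ‖a‖ y) := by
    have hcn : ContinuousAt (fun x : E => ‖x - a‖) a := by fun_prop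
    filter_upwards [nhdsWithin_le_nhds (hcont.eventually (lt_mem_nhds hlt)),
      nhdsWithin_le_nhds (hcn.eventually (gt_mem_nhds (show ‖a - a‖ < ‖a‖ / 2 by
        rw [sub_self, norm_zero]; linarith))),
      self_mem_nhdsWithin] with y h1 h2 (h3 : y ≠ a)
    rw [← norm_pow_mul_kelvin m ha h3]
    refine h1.le.trans (mul_le_mul_of_nonneg_left ?_ (by positivity))
    have := hmin y h3 h2.le
    simp only [Pi.sub_apply] at this
    linarith
  filter_upwards [(tendsto_inversion_cobounded a ha'.ne').eventually hev] with z hz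
  rwa [inversion_inversion a ha'.ne'] at hz

omit [FiniteDimensional ℝ E] in
theorem eventually_le_kelvin (hu : Continuous u) (ha : a ≠ 0) {A : ℝ}
    (hA : ∀ᶠ z in Bornology.cobounded E, A ≤ ‖z‖ ^ m * u z) (hlt : ‖a‖ ^ m * u a < A) :
    ∀ᶠ y in 𝓝[≠] a, u y ≤ kelvin m a ‖a‖ u y := by
  have hcont : ContinuousAt (fun y : E => ‖y‖ ^ m * u y) a := by fun_prop
  filter_upwards [(tendsto_inversion_nhdsNE_center_cobounded (norm_ne_zero_iff.2 ha)).eventually hA,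
    nhdsWithin_le_nhds (hcont.eventually (gt_mem_nhds hlt)), self_mem_nhdsWithin,
    nhdsWithin_le_nhds (eventually_ne_nhds ha)] with y h1 h2 (h3 : y ≠ a) h4
  rw [← norm_pow_mul_kelvin m ha h3] at h1
  have h5 : 0 < ‖y‖ ^ m := pow_pos (norm_pos_iff.2 h4) m
  exact le_of_mul_le_mul_left (h2.le.trans h1) h5

theorem exists_forall_rpow_le (hu : IsMatukumaSolution p u) (R : ℝ) :
    ∃ C > 0, ∀ y, ‖y‖ ≤ R → p * u y ^ (p - 1) ≤ C := by
  have hc : Continuous fun y => p * u y ^ (p - 1) :=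
    continuous_const.mul (hu.contDiff.continuous.rpow_const fun x => Or.inl (hu.pos x).ne')
  obtain ⟨C, hC⟩ := (isCompact_closedBall (0 : E) R).exists_bound_of_continuousOn hc.continuousOn
  refine ⟨max C 1, by positivity, fun y hy => ?_⟩
  exact (le_abs_self _).trans ((hC y (by simpa using hy)).trans (le_max_left _ _))

theorem eventually_kelvinDominates_zero (hu : IsMatukumaSolution p u)
    (hm : Module.finrank ℝ E = m + 2) (hm1 : 1 ≤ m) (hp : 1 ≤ p) (hpm : p * m ≤ m + 2) :
    ∀ᶠ a in 𝓝[≠] 0, KelvinDominates m u a := by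
  obtain ⟨C, hC0, hC⟩ := hu.exists_forall_rpow_le 2
  obtain ⟨c, hc0, hc⟩ := hu.exists_le_norm_pow_mul hm hm1
  have hcob : ∀ᶠ z in Bornology.cobounded E, c ≤ ‖z‖ ^ m * u z :=
    (tendsto_norm_cobounded_atTop.eventually_ge_atTop 1).mono hc
  have h1 : ContinuousAt (fun a : E => ‖a‖ ^ m * u a) 0 := by
    have := hu.contDiff.continuous
    fun_prop
  have h2 : ContinuousAt (fun a : E => ‖a‖ ^ 2) 0 := by fun_prop
  have hε : 0 < min 1 ((m + 2) / C) := by positivity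
  filter_upwards [nhdsWithin_le_nhds (h1.eventually (gt_mem_nhds (show ‖(0 : E)‖ ^ m * u 0 < c by
      simpa [show m ≠ 0 by omega] using hc0))),
    nhdsWithin_le_nhds (h2.eventually (gt_mem_nhds
      (show ‖(0 : E)‖ ^ 2 < min 1 ((m + 2) / C) by simpa using hε))),
    self_mem_nhdsWithin] with a ha1 ha2 (ha : a ≠ 0)
  by_contra hnot
  have ha3 : ‖a‖ < 1 := by
    have := ha2.trans_le (min_le_left _ _)
    nlinarith [norm_nonneg a]
  obtain ⟨y, -, hy, -⟩ := hu.exists_kelvin_lt_of_not_kelvinDominates hm hp hpm (C := C)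
    (fun y hy => hC y (by linarith [norm_sub_norm_le y a])) hε
    ((mul_le_mul_of_nonneg_left (min_le_right _ _) hC0.le).trans_eq (by field_simp))
    (eventually_le_kelvin hu.contDiff.continuous ha hcob ha1) hnot
  linarith [sq_nonneg ‖y - a‖]

theorem eventually_kelvinDominates (hu : IsMatukumaSolution p u)
    (hm : Module.finrank ℝ E = m + 2) (hm1 : 1 ≤ m) (hp : 1 ≤ p) (hpm : p * m ≤ m + 2)
    (ha : a ≠ 0) (h : KelvinDominates m u a) : ∀ᶠ b in 𝓝 a, KelvinDominates m u b := by
  have ha' : 0 < ‖a‖ := norm_pos_iff.2 ha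
  have huc := hu.contDiff.continuous
  obtain ⟨C, hC0, hC⟩ := hu.exists_forall_rpow_le (4 * ‖a‖)
  obtain ⟨A, hA, hAu⟩ := hu.exists_lt_forall_eventually_le hm hm1 hp hpm ha h
  set ε : ℝ := (m + 2) / C with hε
  have hε0 : 0 < ε := by positivity
  have h1 : ContinuousAt (fun b : E => ‖b‖ ^ m * u b) a := by fun_prop
  have h2 : ContinuousAt (fun b : E => ‖b‖) a := by fun_prop
  by_contra hnot
  have hfreq := (not_eventually.1 hnot).and_eventually
    ((h1.eventually (gt_mem_nhds hA)).and ((h2.eventually (gt_mem_nhds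
      (show ‖a‖ < 2 * ‖a‖ by linarith))).and (eventually_ne_nhds ha)))
  obtain ⟨b, hb, hbk⟩ := exists_seq_forall_of_frequently hfreq
  have hex : ∀ k, ∃ y, y ≠ b k ∧ ‖y - b k‖ ^ 2 ≤ ‖b k‖ ^ 2 - ε ∧
      kelvin m (b k) ‖b k‖ u y < u y := fun k => by
    obtain ⟨hk, hk1, hk2, hk3⟩ := hbk k
    exact hu.exists_kelvin_lt_of_not_kelvinDominates hm hp hpm (C := C)
      (fun y hy => hC y (by linarith [norm_sub_norm_le y (b k)])) hε0
      (by rw [hε]; field_simp; rfl) (eventually_le_kelvin huc hk3 hAu hk1) hk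
  choose y hyb hyε hylt using hex
  have hybd : ∀ k, y k ∈ Metric.closedBall (0 : E) (4 * ‖a‖) := fun k => by
    have hk2 := (hbk k).2.2.1
    have h3 : ‖y k - b k‖ ≤ ‖b k‖ :=
      le_of_sq_le_sq ((hyε k).trans (by linarith)) (norm_nonneg _)
    rw [mem_closedBall_zero_iff]
    linarith [norm_sub_norm_le (y k) (b k)]
  obtain ⟨y', -, φ, hφ, hy'⟩ := (isCompact_closedBall (0 : E) (4 * ‖a‖)).tendsto_subseq hybd
  have hbφ := hb.comp hφ.tendsto_atTop
  have hd : Tendsto (fun k => ‖y (φ k) - b (φ k)‖) atTop (𝓝 ‖y' - a‖) := (hy'.sub hbφ).norm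
  have hu' : Tendsto (fun k => u (y (φ k))) atTop (𝓝 (u y')) := (huc.tendsto y').comp hy'
  by_cases hya : y' = a
  · subst hya
    rw [sub_self, norm_zero] at hd
    have hd' : Tendsto (fun k => ‖y (φ k) - b (φ k)‖) atTop (𝓝[>] 0) :=
      tendsto_nhdsWithin_iff.2 ⟨hd, Eventually.of_forall fun k =>
        norm_pos_iff.2 (sub_ne_zero.2 (hyb _))⟩
    have hz : Tendsto (fun k => inversion (b (φ k)) ‖b (φ k)‖ (y (φ k))) atTop
        (Bornology.cobounded E) := by
      rw [← tendsto_norm_atTop_iff_cobounded]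
      have h3 := (tendsto_inv_nhdsGT_zero.comp hd').atTop_mul_pos (mul_pos ha' ha')
        (hbφ.norm.mul hy'.norm)
      refine h3.congr fun k => ?_
      rw [norm_inversion_norm (hbk _).2.2.2 (hyb _)]
      simp only [Function.comp_apply]
      ring
    have h4 : ∀ᶠ k in atTop, A ≤ ‖y (φ k)‖ ^ m * u (y (φ k)) := by
      filter_upwards [hz.eventually hAu] with k hk
      rw [← norm_pow_mul_kelvin m (hbk _).2.2.2 (hyb _)] at hk
      exact hk.trans (mul_le_mul_of_nonneg_left (hylt _).le (by positivity))
    exact absurd (ge_of_tendsto ((hy'.norm.pow m).mul hu') h4) (not_le.2 hA)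
  · have h3 : ‖y' - a‖ ^ 2 ≤ ‖a‖ ^ 2 - ε :=
      le_of_tendsto_of_tendsto' (hd.pow 2) ((hbφ.norm.pow 2).sub_const ε) fun k => hyε _
    have h4 : kelvin m a ‖a‖ u y' ≤ u y' :=
      le_of_tendsto_of_tendsto' ((continuousAt_kelvin_norm m huc hya).tendsto.comp
        (hbφ.prodMk_nhds hy')) hu' fun k => (hylt _).le
    exact absurd (hu.lt_kelvin hm hp hpm h hya
      (lt_of_pow_lt_pow_left₀ 2 (norm_nonneg _) (by linarith))) (not_lt.2 h4)

omit [FiniteDimensional ℝ E] in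
theorem kelvinDominates_of_frequently (hu : Continuous u)
    (h : ∃ᶠ b in 𝓝 a, KelvinDominates m u b) : KelvinDominates m u a := by
  intro y hya hlt
  by_contra! hk
  have h1 : ContinuousAt (fun b : E => kelvin m b ‖b‖ u y) a :=
    (continuousAt_kelvin_norm m hu hya).comp (f := fun b : E => (b, y))
      (continuousAt_id.prodMk continuousAt_const)
  have h2 : ContinuousAt (fun b : E => ‖y - b‖ - ‖b‖) a := by fun_prop
  obtain ⟨b, hb, hb1, hb2, hb3⟩ := (h.and_eventually ((h1.eventually (gt_mem_nhds hk)).and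
    ((h2.eventually (gt_mem_nhds
      (show ‖y - a‖ - ‖a‖ < 0 by linarith))).and (eventually_ne_nhds hya.symm)))).exists
  exact hb1.not_ge (hb y hb3.symm (by linarith))

theorem kelvinDominates (hu : IsMatukumaSolution p u) (hm : Module.finrank ℝ E = m + 2)
    (hm1 : 1 ≤ m) (hp : 1 ≤ p) (hpm : p * m ≤ m + 2) (ha : a ≠ 0) : KelvinDominates m u a := by
  have hrank : 1 < Module.rank ℝ E := by
    rw [← Module.finrank_eq_rank, hm]
    exact_mod_cast (by omega : 1 < m + 2)
  have : Nontrivial E := Module.nontrivial_of_finrank_pos (R := ℝ) (by omega)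
  have hsub := (isConnected_compl_singleton_of_one_lt_rank hrank
    (0 : E)).isPreconnected.subset_of_closure_inter_subset
    (u := {b | b ≠ 0 ∧ KelvinDominates m u b})
    (isOpen_iff_mem_nhds.2 fun b hb => (eventually_ne_nhds hb.1).and
      (hu.eventually_kelvinDominates hm hm1 hp hpm hb.1 hb.2))
    (by
      obtain ⟨b, hb, hb0⟩ := ((hu.eventually_kelvinDominates_zero hm hm1 hp hpm).and
        self_mem_nhdsWithin).exists
      exact ⟨b, hb0, hb0, hb⟩)
    (fun b hb => ⟨hb.2, kelvinDominates_of_frequently hu.contDiff.continuous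
      ((mem_closure_iff_frequently.1 hb.1).mono fun _ h => h.2)⟩)
  exact (hsub ha).2

omit [FiniteDimensional ℝ E] in
theorem le_reflection_of_forall_kelvinDominates (hu : Continuous u)
    (h : ∀ a, a ≠ 0 → KelvinDominates m u a) {e : E} (he : ‖e‖ = 1) (hye : 0 < ⟪y, e⟫) :
    u y ≤ u (y - (2 * ⟪y, e⟫) • e) := by
  set c := ⟪y, e⟫ with hc
  set F : ℝ → ℝ := fun s => (‖s • y - e‖⁻¹) ^ m *
    u ((‖s • y - e‖ ^ 2)⁻¹ • (y + (‖y‖ ^ 2 * s - 2 * c) • e)) with hF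
  have hFc : ContinuousAt F 0 := by
    have h1 : ContinuousAt (fun s : ℝ => ‖s • y - e‖) 0 := by fun_prop
    have h2 : ‖(0 : ℝ) • y - e‖ ≠ 0 := by simp [he]
    have h3 : ContinuousAt (fun s : ℝ => y + (‖y‖ ^ 2 * s - 2 * c) • e) 0 := by fun_prop
    exact ((h1.inv₀ h2).pow m).mul
      (hu.continuousAt.comp (((h1.pow 2).inv₀ (pow_ne_zero 2 h2)).smul h3))
  have hF0 : F 0 = u (y - (2 * c) • e) := by
    simp [hF, he, sub_eq_add_neg]
  rw [← hF0]
  refine ge_of_tendsto (hFc.tendsto.mono_left nhdsWithin_le_nhds : Tendsto F (𝓝[>] 0) _) ?_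
  have hs1 : ContinuousAt (fun s : ℝ => s * ‖y‖) 0 := by fun_prop
  have hs2 : ContinuousAt (fun s : ℝ => s * ‖y‖ ^ 2) 0 := by fun_prop
  filter_upwards [self_mem_nhdsWithin,
    nhdsWithin_le_nhds (hs1.eventually (gt_mem_nhds (show 0 * ‖y‖ < 1 by simp))),
    nhdsWithin_le_nhds (hs2.eventually (gt_mem_nhds (show 0 * ‖y‖ ^ 2 < 2 * c by linarith)))]
    with s (hs : 0 < s) h1 h2
  have hna : ‖s⁻¹ • e‖ = s⁻¹ := by rw [norm_smul, he, mul_one, Real.norm_of_nonneg (by positivity)]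
  have hsub : y - s⁻¹ • e = s⁻¹ • (s • y - e) := by
    rw [smul_sub, smul_smul, inv_mul_cancel₀ hs.ne', one_smul]
  have hnsub : ‖y - s⁻¹ • e‖ = s⁻¹ * ‖s • y - e‖ := by
    rw [hsub, norm_smul, Real.norm_of_nonneg (by positivity)]
  have hD : ‖s • y - e‖ ^ 2 = s ^ 2 * ‖y‖ ^ 2 - 2 * (s * c) + 1 := by
    rw [norm_sub_sq_real, norm_smul, real_inner_smul_left, he, Real.norm_of_nonneg hs.le]
    ring
  have hne : y ≠ s⁻¹ • e := by
    intro h3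
    rw [h3, hna, mul_inv_cancel₀ hs.ne'] at h1
    exact lt_irrefl _ h1
  have hpos : 0 < ‖s • y - e‖ := by
    have := norm_pos_iff.2 (sub_ne_zero.2 hne)
    rw [hnsub] at this
    exact pos_of_mul_pos_right this (by positivity)
  have hlt : ‖s • y - e‖ < 1 := by
    have : ‖s • y - e‖ ^ 2 < 1 := by nlinarith
    nlinarith
  have hK := h (s⁻¹ • e) (norm_pos_iff.1 (by rw [hna]; positivity)) y hne
    (by rw [hnsub, hna]; exact mul_lt_of_lt_one_right (by positivity) hlt)
  refine hK.trans_eq ?_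
  rw [kelvin, inversion_eq_add_smul, hna, hnsub, hF]
  congr 2
  · field_simp
  · rw [hsub]
    have h5 : (s⁻¹ ^ 2 * ((s⁻¹ * ‖s • y - e‖) ^ 2)⁻¹) = (‖s • y - e‖ ^ 2)⁻¹ := by
      field_simp
    rw [h5]
    have h6 : s⁻¹ • e = (‖s • y - e‖ ^ 2)⁻¹ • (s⁻¹ * ‖s • y - e‖ ^ 2) • e := by
      rw [smul_smul]
      congr 1
      field_simp
    rw [h6, ← smul_add, hD]
    congr 1
    rw [smul_sub, smul_smul, inv_mul_cancel₀ hs.ne', one_smul, add_sub_left_comm, ← sub_smul]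
    congr 2
    field_simp
    ring

theorem le_of_norm_eq (hu : IsMatukumaSolution p u) (hm : Module.finrank ℝ E = m + 2)
    (hm1 : 1 ≤ m) (hp : 1 ≤ p) (hpm : p * m ≤ m + 2) {x z : E} (hxz : ‖x‖ = ‖z‖) :
    u x ≤ u z := by
  rcases eq_or_ne x z with rfl | hne
  · rfl
  have hd : 0 < ‖x - z‖ := norm_pos_iff.2 (sub_ne_zero.2 hne)
  have hin : ‖x - z‖ ^ 2 = 2 * ⟪x, x - z⟫ := by
    rw [norm_sub_sq_real, inner_sub_right, real_inner_self_eq_norm_sq, ← hxz]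
    ring
  have he : ‖‖x - z‖⁻¹ • (x - z)‖ = 1 := by
    rw [norm_smul, norm_inv, norm_norm, inv_mul_cancel₀ hd.ne']
  have hxe : 2 * ⟪x, ‖x - z‖⁻¹ • (x - z)⟫ = ‖x - z‖ := by
    rw [real_inner_smul_right, mul_left_comm, ← hin]
    field_simp
  have h := le_reflection_of_forall_kelvinDominates hu.contDiff.continuous
    (fun a ha => hu.kelvinDominates hm hm1 hp hpm ha) he (y := x) (by linarith)
  rwa [hxe, smul_smul, mul_inv_cancel₀ hd.ne', one_smul, sub_sub_cancel] at h

end IsMatukumaSolution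

end Matukuma

theorem stmt11 (n : ℕ) (hn : 3 ≤ n) (p : ℝ) (hp1 : 1 ≤ p) (hp2 : p ≤ (n : ℝ) / ((n : ℝ) - 2))
    (u : EuclideanSpace ℝ (Fin n) → ℝ)
    (hu : ContDiff ℝ (⊤ : ℕ∞) u)
    (hpos : ∀ x : EuclideanSpace ℝ (Fin n), 0 < u x)
    (heq : ∀ x : EuclideanSpace ℝ (Fin n),
      -eLaplacian u x = u x ^ p / (1 + ‖x‖ ^ 2)) :
    ∀ x y : EuclideanSpace ℝ (Fin n), ‖x‖ = ‖y‖ → u x = u y := by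
  obtain ⟨m, rfl⟩ : ∃ m, n = m + 2 := ⟨n - 2, by omega⟩
  have hm1 : 1 ≤ m := by omega
  have hu' : IsMatukumaSolution p u := by
    refine ⟨hu.of_le (WithTop.coe_le_coe.2 le_top), hpos, fun x => ?_⟩
    rw [← heq x, neg_neg,
      laplacian_eq_iteratedFDeriv_orthonormalBasis u (EuclideanSpace.basisFun (Fin (m + 2)) ℝ)]
    simp [eLaplacian]
  have hpm : p * m ≤ m + 2 := by
    have h0 : (0 : ℝ) < m := by exact_mod_cast hm1
    push_cast at hp2
    rwa [add_sub_cancel_right, le_div_iff₀ h0] at hp2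
  have hm : Module.finrank ℝ (EuclideanSpace ℝ (Fin (m + 2))) = m + 2 := by simp
  exact fun x y hxy => le_antisymm (hu'.le_of_norm_eq hm hm1 hp1 hpm hxy)
    (hu'.le_of_norm_eq hm hm1 hp1 hpm hxy.symm)
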